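/- Let Θ ⊆ I and let (w₁, w₂) and (w₁', w₂') be two pairs with w₁, w₁' ∈ W^Θ and w₂, w₂' ∈ ^{Θ∪Θ^⊥}W, and suppose (w₁, w₂) ≠ (w₁', w₂'). If there exists w ∈ W_{Θ^⊥} with w₁' ≥ w₁w and w₂' ≥ w⁻¹w₂ in the Bruhat order, then ℓ(w₁) + ℓ(w₂) < ℓ(w₁') + ℓ(w₂'). (Strict monotonicity of the extended length function l₋₊ with respect to the extended order ≤₋₊ within one W×W-orbit of the Weyl monoid.) -/

import Mathlib

open Classical

namespace Paper

variable {B : Type*} {M : CoxeterMatrix B} {W : Type*} [Group W]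

/-- `Θ^⊥`: the indices whose simple reflections commute with all simple
reflections indexed by `Θ` (i.e. `m(i,j) = 2` for all `j ∈ Θ`). -/
def perp (M : CoxeterMatrix B) (Θ : Set B) : Set B := {i | i ∉ Θ ∧ ∀ j ∈ Θ, M i j = 2}

variable (cs : CoxeterSystem M W)

/-- The standard parabolic subgroup `W_J` generated by the simple reflections indexed by `J`. -/
def parabolic (J : Set B) : Subgroup W := Subgroup.closure (cs.simple '' J)

/-- `W^J`: the minimal-length representatives of the cosets `W/W_J`,
`{w : ℓ(wu) = ℓ(w) + ℓ(u) for all u ∈ W_J}`. -/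
def minRight (J : Set B) : Set W :=
  {w | ∀ u ∈ parabolic cs J, cs.length (w * u) = cs.length w + cs.length u}

/-- `^JW`: the minimal-length representatives of the cosets `W_J\W`,
`{w : ℓ(uw) = ℓ(u) + ℓ(w) for all u ∈ W_J}`. -/
def minLeft (J : Set B) : Set W :=
  {w | ∀ u ∈ parabolic cs J, cs.length (u * w) = cs.length u + cs.length w}

/-- The Bruhat order on `W`: `x ≤ y` iff `y` is obtained from `x` by a chain of
right multiplications by reflections, each strictly increasing the length. -/
def bruhatLE : W → W → Prop :=
  Relation.ReflTransGen (fun x y => ∃ t, cs.IsReflection t ∧ y = x * t ∧ cs.length x < cs.length y)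

/-- The equivalence relation `∼_Θ` on `W × W`:
`(x,y) ∼_Θ (x',y')` iff there are `u ∈ W_{Θ∪Θ^⊥}` and `v ∈ W_Θ` with `x' = xu`, `y' = u⁻¹vy`. -/
def simRel (Θ : Set B) (p q : W × W) : Prop :=
  ∃ u ∈ parabolic cs (Θ ∪ perp M Θ), ∃ v ∈ parabolic cs Θ,
    q.1 = p.1 * u ∧ q.2 = u⁻¹ * v * p.2

/-- `w^J`: the minimal-length element of the coset `w W_J`. -/
noncomputable def projR (J : Set B) (w : W) : W :=
  if h : ∃ a, a ∈ minRight cs J ∧ a⁻¹ * w ∈ parabolic cs J then h.choose else w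

/-- `^Jw`: the minimal-length element of the coset `W_J w`. -/
noncomputable def projL (J : Set B) (w : W) : W :=
  if h : ∃ a, a ∈ minLeft cs J ∧ w * a⁻¹ ∈ parabolic cs J then h.choose else w

/-- The Bruhat order is strictly compatible with the length function. -/
theorem bruhatLE.eq_or_length_lt {x y : W} (h : bruhatLE cs x y) :
    x = y ∨ cs.length x < cs.length y := by
  induction h with
  | refl => exact Or.inl rfl
  | tail _ hstep ih =>
    obtain ⟨t, -, -, hlt⟩ := hstep
    rcases ih with rfl | ih
    · exact Or.inr hlt
    · exact Or.inr (ih.trans hlt)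

/-- Parabolic subgroups are monotone in the index set. -/
theorem parabolic_mono {J K : Set B} (h : J ⊆ K) : parabolic cs J ≤ parabolic cs K :=
  Subgroup.closure_mono (Set.image_mono h)

/-- strict monotonicity of the extended length `l₋₊ = ℓ(w₁) + ℓ(w₂)`
with respect to the extended order `≤₋₊` inside one `W×W`-orbit. -/
theorem statement11 [Finite B] (Θ : Set B) (w₁ w₂ w₁' w₂' : W)
    (h₁ : w₁ ∈ minRight cs Θ) (h₂ : w₂ ∈ minLeft cs (Θ ∪ perp M Θ))
    (h₁' : w₁' ∈ minRight cs Θ) (h₂' : w₂' ∈ minLeft cs (Θ ∪ perp M Θ))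
    (hne : (w₁, w₂) ≠ (w₁', w₂'))
    (h : ∃ w ∈ parabolic cs (perp M Θ),
        bruhatLE cs (w₁ * w) w₁' ∧ bruhatLE cs (w⁻¹ * w₂) w₂') :
    cs.length w₁ + cs.length w₂ < cs.length w₁' + cs.length w₂' := by
  obtain ⟨w, hw, hb₁, hb₂⟩ := h
  have hw' : w ∈ parabolic cs (Θ ∪ perp M Θ) :=
    parabolic_mono cs Set.subset_union_right hw
  have hl₂ : cs.length (w⁻¹ * w₂) = cs.length w + cs.length w₂ := by
    rw [h₂ _ (inv_mem hw'), cs.length_inv]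
  have hl₁ : cs.length w₁ ≤ cs.length (w₁ * w) + cs.length w :=
    cs.length_le_length_mul_add_right w₁ w
  rcases hb₁.eq_or_length_lt with rfl | hlt₁ <;> rcases hb₂.eq_or_length_lt with rfl | hlt₂
  · have hl₂' := h₂' w hw'
    rw [mul_inv_cancel_left] at hl₂'
    have hw1 : w = 1 := cs.length_eq_zero_iff.mp (by omega)
    simp [hw1] at hne
  all_goals omega

end Paper
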